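/- Let n ≥ 1, q ≥ 1, and let f : ([0,1])^n → ℝ^q be a continuous function that is invariant under every permutation of its n arguments. Then there exist continuous functions γ : ℝ^{n+1} → ℝ^q and h : [0,1] → ℝ^{n+1} such that for all x ∈ [0,1]^n, f(x₁, …, xₙ) = γ(h(x₁) + ⋯ + h(xₙ)). In particular, for every ε > 0, ‖f(x) − γ(Σ_i h(x_i))‖ = 0 < ε for all x ∈ [0,1]^n. -/

import Mathlib

theorem dsv_esymm_eq {n : ℕ} (x y : Fin n → ℝ)
    (h : ∀ j : ℕ, j ≤ n → ∑ i, x i ^ j = ∑ i, y i ^ j) (k : ℕ) (hk : k ≤ n) :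
    MvPolynomial.aeval x (MvPolynomial.esymm (Fin n) ℝ k) =
      MvPolynomial.aeval y (MvPolynomial.esymm (Fin n) ℝ k) := by
  induction k using Nat.strong_induction_on with
  | _ k ih =>
    rcases Nat.eq_zero_or_pos k with rfl | hk0
    · simp
    · have key := MvPolynomial.mul_esymm_eq_sum (Fin n) ℝ k
      have hx := congrArg (MvPolynomial.aeval x) key
      have hy := congrArg (MvPolynomial.aeval y) key
      simp only [map_mul, map_sum, map_natCast, map_pow, map_neg, map_one] at hx hy
      have hk' : (k : ℝ) ≠ 0 := by positivity
      apply mul_left_cancel₀ hk'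
      rw [hx, hy]
      congr 1
      apply Finset.sum_congr rfl
      intro a ha
      rw [Finset.mem_filter] at ha
      have ha1 : a.1 + a.2 = k := Finset.HasAntidiagonal.mem_antidiagonal.1 ha.1
      rw [ih a.1 ha.2 (by omega)]
      congr 1
      simp only [MvPolynomial.psum, map_sum, map_pow, MvPolynomial.aeval_X]
      exact h _ (by omega)

theorem dsv_perm {n : ℕ} (x y : Fin n → ℝ)
    (h : ∀ j : ℕ, j ≤ n → ∑ i, x i ^ j = ∑ i, y i ^ j) :
    ∃ σ : Equiv.Perm (Fin n), x = y ∘ σ := by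
  have hm : Finset.univ.val.map x = Finset.univ.val.map y := by
    rw [← Polynomial.roots_multiset_prod_X_sub_C (Finset.univ.val.map x),
      ← Polynomial.roots_multiset_prod_X_sub_C (Finset.univ.val.map y)]
    congr 1
    rw [Multiset.prod_X_sub_X_eq_sum_esymm, Multiset.prod_X_sub_X_eq_sum_esymm]
    simp only [Multiset.card_map]
    apply Finset.sum_congr rfl
    intro j hj
    have hj' : j ≤ n := by
      simp at hj
      omega
    have := dsv_esymm_eq x y h j hj'
    rw [MvPolynomial.aeval_esymm_eq_multiset_esymm,
      MvPolynomial.aeval_esymm_eq_multiset_esymm] at this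
    rw [this]
  have hc : ∀ c : ℝ, Fintype.card {a // x a = c} = Fintype.card {b // y b = c} := by
    intro c
    have := congrArg (Multiset.count c) hm
    rw [Multiset.count_map, Multiset.count_map] at this
    rw [Fintype.card_subtype, Fintype.card_subtype]
    simpa only [eq_comm, Finset.card_def, Finset.filter_val] using this
  refine ⟨Equiv.ofFiberEquiv fun c => Fintype.equivOfCardEq (hc c), ?_⟩
  funext a
  exact (Equiv.ofFiberEquiv_map _ a).symm


/-- **DeepSets sum-decomposition, vector-valued case.** Let `n ≥ 1`, `q ≥ 1`,
and let `f : [0,1]^n → ℝ^q` be continuous and invariant under every permutation of its `n`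
arguments. Then there are continuous `γ : ℝ^{n+1} → ℝ^q` and `h : [0,1] → ℝ^{n+1}` such that
`f x = γ (h x₁ + ⋯ + h xₙ)` for all `x ∈ [0,1]^n`; in particular for every `ε > 0`,
`‖f x − γ (∑ i, h (x i))‖ = 0 < ε` for all such `x`. -/
theorem deepsets_decomposition_vector
    (n q : ℕ) (hn : 1 ≤ n) (hq : 1 ≤ q)
    (f : (Fin n → ℝ) → EuclideanSpace ℝ (Fin q))
    (hf : ContinuousOn f {x : Fin n → ℝ | ∀ i, x i ∈ Set.Icc (0 : ℝ) 1})
    (hsymm : ∀ x : Fin n → ℝ, (∀ i, x i ∈ Set.Icc (0 : ℝ) 1) →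
      ∀ σ : Equiv.Perm (Fin n), f (x ∘ σ) = f x) :
    ∃ (γ : (Fin (n + 1) → ℝ) → EuclideanSpace ℝ (Fin q)) (h : ℝ → (Fin (n + 1) → ℝ)),
      Continuous γ ∧ ContinuousOn h (Set.Icc (0 : ℝ) 1) ∧
      ∀ x : Fin n → ℝ, (∀ i, x i ∈ Set.Icc (0 : ℝ) 1) →
        f x = γ (∑ i : Fin n, h (x i)) ∧
        ∀ ε : ℝ, 0 < ε →
          ‖f x - γ (∑ i : Fin n, h (x i))‖ = 0 ∧
          ‖f x - γ (∑ i : Fin n, h (x i))‖ < ε := by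
  set K : Set (Fin n → ℝ) := {x | ∀ i, x i ∈ Set.Icc (0 : ℝ) 1} with hK
  have hKc : IsCompact K := by
    have : K = Set.univ.pi fun _ => Set.Icc (0 : ℝ) 1 := by
      ext x
      simp only [hK, Set.mem_ofPred_eq, Set.mem_pi, Set.mem_univ, true_imp_iff]
    rw [this]
    exact isCompact_univ_pi fun _ => isCompact_Icc
  have : CompactSpace K := isCompact_iff_compactSpace.1 hKc
  let h : ℝ → (Fin (n + 1) → ℝ) := fun t j => t ^ (j : ℕ)
  have hh : Continuous h := by fun_prop
  let E : K → (Fin (n + 1) → ℝ) := fun x => ∑ i, h (x.1 i)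
  have hE : Continuous E := by
    exact continuous_finsetSum _ fun i _ =>
      hh.comp ((continuous_apply i).comp continuous_subtype_val)
  have hfac : ∀ a b : K, E a = E b → f a = f b := by
    intro a b hab
    obtain ⟨σ, hσ⟩ := dsv_perm a.1 b.1 (by
      intro j hj
      have := congrFun hab ⟨j, by omega⟩
      simpa [E, h] using this)
    rw [hσ]
    exact hsymm b.1 b.2 σ
  let F : C(K, Set.range E) := ⟨Set.rangeFactorization E, hE.subtype_mk _⟩
  have hFq : Topology.IsQuotientMap F :=
    F.continuous.isClosedMap.isQuotientMap F.continuous Set.rangeFactorization_surjective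
  let fK : C(K, EuclideanSpace ℝ (Fin q)) := ⟨K.domRestrict f, hf.domRestrict⟩
  have hclosed : IsClosed (Set.range E) := (isCompact_range hE).isClosed
  have hft : Function.FactorsThrough fK F := by
    intro a b hab
    exact hfac a b (congrArg Subtype.val hab)
  let g : C(Set.range E, EuclideanSpace ℝ (Fin q)) := hFq.lift fK hft
  obtain ⟨γ, hγ⟩ := g.exists_restrict_eq hclosed
  have main : ∀ x : Fin n → ℝ, (∀ i, x i ∈ Set.Icc (0 : ℝ) 1) →
      f x = γ (∑ i : Fin n, h (x i)) := by
    intro x hx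
    have h1 : g (F ⟨x, hx⟩) = f x :=
      congrArg (fun u : C(K, EuclideanSpace ℝ (Fin q)) => u ⟨x, hx⟩) (hFq.lift_comp fK hft)
    have h2 := congrArg (fun u : C(Set.range E, EuclideanSpace ℝ (Fin q)) => u (F ⟨x, hx⟩)) hγ
    exact h1.symm.trans h2.symm
  refine ⟨γ, h, γ.continuous, hh.continuousOn, fun x hx => ⟨main x hx, fun ε hε => ?_⟩⟩
  rw [← main x hx]
  simpa using hε
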